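/- Assume MFCQ holds at every x ∈ ℝ^n, the convexity assumption holds, 0 < α < μ, and 0 < T ≤ 2/(L_l + μ), where additionally L_l bounds the Lipschitz constant of y ↦ ∇_x l(y, λ*_I) for every index set I ⊆ {1,…,n_g}. Then for any x_0 ∈ ℝ^n, the iterates x_{k+1} := x_k + T v(x_k) are well defined and converge to the unique minimizer x* of f over C, and d(x_k) increases monotonically to f*. -/

import Mathlib

open scoped RealInnerProductSpace
open Filter


section GradientInequalities

variable {E : Type*} [NormedAddCommGroup E] [InnerProductSpace ℝ E]

/-- Derivative of a function along a line, in terms of its gradient. -/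
theorem HasGradientAt.hasDerivAt_line [CompleteSpace E] {F : E → ℝ} {G x e : E} {t : ℝ}
    (hF : HasGradientAt F G (x + t • e)) :
    HasDerivAt (fun s : ℝ => F (x + s • e)) ⟪G, e⟫ t := by
  have hline : HasDerivAt (fun s : ℝ => x + s • e) e t := by
    simpa using ((hasDerivAt_id t).smul_const e).const_add x
  simpa [Function.comp_def] using! hF.hasFDerivAt.comp_hasDerivAt t hline

/-- A convex function lies above its tangent planes. -/
theorem ConvexOn.add_inner_gradient_le [CompleteSpace E] {F : E → ℝ} {G x : E}
    (hc : ConvexOn ℝ Set.univ F) (hF : HasGradientAt F G x) (y : E) :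
    F x + ⟪G, y - x⟫ ≤ F y := by
  have hd : HasDerivAt (fun s : ℝ => F (x + s • (y - x))) ⟪G, y - x⟫ 0 :=
    HasGradientAt.hasDerivAt_line (by simpa using hF)
  have hc' : ConvexOn ℝ Set.univ (fun s : ℝ => F (x + s • (y - x))) := by
    have := hc.comp_affineMap (AffineMap.lineMap x y : ℝ →ᵃ[ℝ] E)
    refine this.congr fun s _ => ?_
    simp [AffineMap.lineMap_apply, add_comm]
  have := hc'.le_slope_of_hasDerivAt (Set.mem_univ 0) (Set.mem_univ 1) zero_lt_one hd
  simp [slope_def_field] at this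
  linarith

/-- A concave function lies below its tangent planes. -/
theorem ConcaveOn.le_add_inner_gradient [CompleteSpace E] {F : E → ℝ} {G x : E}
    (hc : ConcaveOn ℝ Set.univ F) (hF : HasGradientAt F G x) (y : E) :
    F y ≤ F x + ⟪G, y - x⟫ := by
  have hF' : HasGradientAt (-F) (-G) x := by
    rw [hasGradientAt_iff_hasFDerivAt] at hF ⊢
    simpa using hF.neg
  have := hc.neg.add_inner_gradient_le hF' y
  simp only [Pi.neg_apply, inner_neg_left] at this
  linarith

/-- A strongly convex function lies above its tangent paraboloids. -/
theorem StrongConvexOn.add_inner_gradient_le [CompleteSpace E] {F : E → ℝ} {G x : E} {m : ℝ}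
    (hc : StrongConvexOn Set.univ m F) (hF : HasGradientAt F G x) (y : E) :
    F x + ⟪G, y - x⟫ + m / 2 * ‖y - x‖ ^ 2 ≤ F y := by
  have hF' : HasGradientAt (fun z => F z - m / 2 * ‖z‖ ^ 2) (G - m • x) x := by
    rw [hasGradientAt_iff_hasFDerivAt] at hF ⊢
    refine (hF.sub (((hasStrictFDerivAt_norm_sq x).hasFDerivAt).const_mul (m / 2))).congr_fderiv ?_
    ext z
    simp
    ring
  have := (strongConvexOn_iff_convex.1 hc).add_inner_gradient_le hF' y
  have e1 : ‖y‖ ^ 2 = ‖x‖ ^ 2 + 2 * ⟪x, y - x⟫ + ‖y - x‖ ^ 2 := by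
    rw [← norm_add_sq_real]; simp
  rw [inner_sub_left, real_inner_smul_left, e1] at this
  linarith

/-- The descent lemma. -/
theorem le_add_inner_gradient_add_sq [CompleteSpace E] {F : E → ℝ} {G : E → E} {L : ℝ}
    (hF : ∀ y, HasGradientAt F (G y) y) (hL : ∀ y z, ‖G y - G z‖ ≤ L * ‖y - z‖) (x y : E) :
    F y ≤ F x + ⟪G x, y - x⟫ + L / 2 * ‖y - x‖ ^ 2 := by
  set e := y - x
  have hd (t : ℝ) : HasDerivAt
      (fun s : ℝ => F (x + s • e) - s * ⟪G x, e⟫ - L / 2 * ‖e‖ ^ 2 * s ^ 2)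
      (⟪G (x + t • e), e⟫ - ⟪G x, e⟫ - L * ‖e‖ ^ 2 * t) t := by
    refine (((hF (x + t • e)).hasDerivAt_line.sub ((hasDerivAt_id t).mul_const ⟪G x, e⟫)).sub
      ((hasDerivAt_pow 2 t).const_mul (L / 2 * ‖e‖ ^ 2))).congr_deriv ?_
    simp
    ring
  have hanti : AntitoneOn
      (fun s : ℝ => F (x + s • e) - s * ⟪G x, e⟫ - L / 2 * ‖e‖ ^ 2 * s ^ 2) (Set.Icc 0 1) := by
    refine antitoneOn_of_deriv_nonpos (convex_Icc 0 1)
      (fun t _ => (hd t).continuousAt.continuousWithinAt)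
      (fun t _ => (hd t).differentiableAt.differentiableWithinAt) fun t ht => ?_
    rw [interior_Icc] at ht
    have h1 := hL (x + t • e) x
    rw [add_sub_cancel_left, norm_smul, Real.norm_of_nonneg ht.1.le] at h1
    have h2 := real_inner_le_norm (G (x + t • e) - G x) e
    rw [inner_sub_left] at h2
    have h3 := mul_le_mul_of_nonneg_right h1 (norm_nonneg e)
    rw [(hd t).deriv]
    linarith
  have := hanti (Set.left_mem_Icc.2 zero_le_one) (Set.right_mem_Icc.2 zero_le_one) zero_le_one
  simp [e] at this ⊢
  linarith

/-- Cocoercivity of the gradient of a smooth convex function (Baillon–Haddad). -/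
theorem norm_sub_sq_le_mul_inner_of_tangent_bounds {F : E → ℝ} {G : E → E} {K : ℝ} (hK : 0 ≤ K)
    (hlow : ∀ x y, F x + ⟪G x, y - x⟫ ≤ F y)
    (hup : ∀ x y, F y ≤ F x + ⟪G x, y - x⟫ + K / 2 * ‖y - x‖ ^ 2) (x y : E) :
    ‖G y - G x‖ ^ 2 ≤ K * ⟪G y - G x, y - x⟫ := by
  have key (t : ℝ) (x y : E) :
      F x + ⟪G x, y - x⟫ + (t - K * t ^ 2 / 2) * ‖G y - G x‖ ^ 2 ≤ F y := by
    have h1 := hlow x (y - t • (G y - G x))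
    have h2 := hup y (y - t • (G y - G x))
    have e1 : y - t • (G y - G x) - x = (y - x) - t • (G y - G x) := by abel
    have e2 : y - t • (G y - G x) - y = -(t • (G y - G x)) := by abel
    rw [e1, inner_sub_right, real_inner_smul_right] at h1
    rw [e2, inner_neg_right, real_inner_smul_right, norm_neg, norm_smul, mul_pow,
      Real.norm_eq_abs, sq_abs] at h2
    have e3 : ‖G y - G x‖ ^ 2 = ⟪G y, G y - G x⟫ - ⟪G x, G y - G x⟫ := by
      rw [← inner_sub_left, real_inner_self_eq_norm_sq]
    have e4 : t * ‖G y - G x‖ ^ 2 = t * ⟪G y, G y - G x⟫ - t * ⟪G x, G y - G x⟫ := by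
      rw [e3]; ring
    linarith
  have hsum (t : ℝ) : (2 * t - K * t ^ 2) * ‖G y - G x‖ ^ 2 ≤ ⟪G y - G x, y - x⟫ := by
    have h1 := key t x y
    have h2 := key t y x
    rw [norm_sub_rev (G x), ← neg_sub y x, inner_neg_right] at h2
    rw [inner_sub_left]
    linarith
  rcases hK.eq_or_lt with rfl | hK
  · set D := ‖G y - G x‖ ^ 2
    have hD : 0 ≤ D := by positivity
    by_contra! hlt
    rw [zero_mul] at hlt
    have := hsum ((⟪G y - G x, y - x⟫ + 1) / (2 * D))
    rw [zero_mul, sub_zero, mul_assoc, show 2 * ((⟪G y - G x, y - x⟫ + 1) / (2 * D) * D)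
      = ⟪G y - G x, y - x⟫ + 1 by field_simp] at this
    linarith
  · have := mul_le_mul_of_nonneg_left (hsum (1 / K)) hK.le
    rwa [← mul_assoc, show K * (2 * (1 / K) - K * (1 / K) ^ 2) = 1 by field_simp; ring,
      one_mul] at this

/-- A gradient step of size at most `2 / (L + m)` contracts the gradient by `1 - m * T`. -/
theorem norm_gradient_step_sq_le [CompleteSpace E] {F : E → ℝ} {G : E → E} {m L T : ℝ}
    (hm : 0 < m) (hmL : m ≤ L) (hT0 : 0 < T) (hT : T ≤ 2 / (L + m))
    (hF : ∀ y, HasGradientAt F (G y) y)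
    (hlow : ∀ x y, F x + ⟪G x, y - x⟫ + m / 2 * ‖y - x‖ ^ 2 ≤ F y)
    (hL : ∀ y z, ‖G y - G z‖ ≤ L * ‖y - z‖) (x : E) :
    ‖G (x - T • G x)‖ ^ 2 ≤ (1 - m * T) ^ 2 * ‖G x‖ ^ 2 := by
  have hsq (x y : E) : ‖y‖ ^ 2 = ‖x‖ ^ 2 + 2 * ⟪x, y - x⟫ + ‖y - x‖ ^ 2 := by
    rw [← norm_add_sq_real]; simp
  have hco := norm_sub_sq_le_mul_inner_of_tangent_bounds (F := fun z => F z - m / 2 * ‖z‖ ^ 2)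
    (G := fun z => G z - m • z) (K := L - m) (by linarith)
    (fun x y => by
      have := hlow x y
      simp only [inner_sub_left, real_inner_smul_left, hsq x y]
      linarith)
    (fun x y => by
      have := le_add_inner_gradient_add_sq hF hL x y
      simp only [inner_sub_left, real_inner_smul_left, hsq x y]
      linarith) x (x - T • G x)
  have hmono : m * ‖T • G x‖ ^ 2 ≤ ⟪G (x - T • G x) - G x, -(T • G x)⟫ := by
    have h1 := hlow x (x - T • G x)
    have h2 := hlow (x - T • G x) x
    simp only [sub_sub_cancel_left, sub_sub_cancel, norm_neg, inner_neg_right, inner_sub_left]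
      at h1 h2 ⊢
    linarith
  set P := G (x - T • G x)
  obtain ⟨D, hD⟩ : ∃ D, P = G x + D := ⟨P - G x, by abel⟩
  have e1 : P - m • (x - T • G x) - (G x - m • x) = D + (m * T) • G x := by
    rw [hD, smul_sub, smul_smul]; abel
  have e2 : x - T • G x - x = -(T • G x) := by abel
  simp only [e1, e2] at hco
  rw [hD, add_sub_cancel_left, norm_smul, inner_neg_right, real_inner_smul_right, mul_pow,
    Real.norm_eq_abs, sq_abs] at hmono
  rw [hD, norm_add_sq_real, real_inner_comm]
  rw [norm_add_sq_real, norm_smul, inner_neg_right, real_inner_smul_right, real_inner_smul_right,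
    inner_add_left, real_inner_smul_left, real_inner_self_eq_norm_sq, mul_pow,
    Real.norm_eq_abs, sq_abs] at hco
  have hTL : T * (L + m) ≤ 2 := (le_div_iff₀ (by linarith)).1 hT
  generalize hdg : ⟪D, G x⟫ = p at *
  have hG : 0 ≤ ‖G x‖ ^ 2 := by positivity
  generalize ‖G x‖ ^ 2 = a at *
  generalize ‖D‖ ^ 2 = b at *
  have hmono' : p ≤ -(m * T) * a := by
    by_contra! hlt
    nlinarith
  have hfin : 0 ≤ (p + m * T * a) * (T * (L + m) - 2) :=
    mul_nonneg_of_nonpos_of_nonpos (by linarith) (by linarith)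
  nlinarith

end GradientInequalities

section Lagrangian

variable {E : Type*} [NormedAddCommGroup E] [InnerProductSpace ℝ E] [CompleteSpace E]
  {ι κ : Type*} [Fintype ι] [Fintype κ]
  {f : E → ℝ} {g : ι → E → ℝ} {h : κ → E → ℝ} {gf : E → E} {gg : ι → E → E} {gh : κ → E → E}

theorem hasGradientAt_lagrangian (hf : ∀ y, HasGradientAt f (gf y) y)
    (hg : ∀ i y, HasGradientAt (g i) (gg i y) y) (hh : ∀ j y, HasGradientAt (h j) (gh j y) y)
    (a : κ → ℝ) (b : ι → ℝ) (y : E) :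
    HasGradientAt (fun z => f z - ((∑ j, a j * h j z) + ∑ i, b i * g i z))
      (gf y - ((∑ j, a j • gh j y) + ∑ i, b i • gg i y)) y := by
  simp only [hasGradientAt_iff_hasFDerivAt, map_sub, map_add, map_sum, map_smulₛₗ] at *
  exact (hf y).sub ((HasFDerivAt.fun_sum fun j _ => (hh j y).const_mul (a j)).add
    (HasFDerivAt.fun_sum fun i _ => (hg i y).const_mul (b i)))

theorem lagrangian_add_inner_gradient_le (hf : ∀ y, HasGradientAt f (gf y) y)
    (hg : ∀ i y, HasGradientAt (g i) (gg i y) y) (hh : ∀ j y, HasGradientAt (h j) (gh j y) y)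
    (hhaff : ∀ j, ConvexOn ℝ Set.univ (h j) ∧ ConcaveOn ℝ Set.univ (h j))
    (hgconc : ∀ i, ConcaveOn ℝ Set.univ (g i)) {μ : ℝ} (hfsc : StrongConvexOn Set.univ μ f)
    (a : κ → ℝ) {b : ι → ℝ} (hb : ∀ i, 0 ≤ b i) (x y : E) :
    f x - ((∑ j, a j * h j x) + ∑ i, b i * g i x) +
        ⟪gf x - ((∑ j, a j • gh j x) + ∑ i, b i • gg i x), y - x⟫ + μ / 2 * ‖y - x‖ ^ 2 ≤
      f y - ((∑ j, a j * h j y) + ∑ i, b i * g i y) := by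
  have h1 := hfsc.add_inner_gradient_le (hf x) y
  have h2 : ∑ j, a j * h j y = ∑ j, a j * h j x + ∑ j, a j * ⟪gh j x, y - x⟫ := by
    rw [← Finset.sum_add_distrib]
    refine Finset.sum_congr rfl fun j _ => ?_
    rw [← mul_add, ((hhaff j).1.add_inner_gradient_le (hh j x) y).antisymm
      ((hhaff j).2.le_add_inner_gradient (hh j x) y)]
  have h3 : ∑ i, b i * g i y ≤ ∑ i, b i * g i x + ∑ i, b i * ⟪gg i x, y - x⟫ := by
    rw [← Finset.sum_add_distrib]
    refine Finset.sum_le_sum fun i _ => ?_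
    rw [← mul_add]
    exact mul_le_mul_of_nonneg_left ((hgconc i).le_add_inner_gradient (hg i x) y) (hb i)
  simp only [inner_sub_left, inner_add_left, sum_inner, real_inner_smul_left]
  linarith

end Lagrangian

/-- under MFCQ everywhere, the convexity assumption, `0 < α < μ`, and
`0 < T ≤ 2/(L_l + μ)`, where additionally `L_l` bounds the Lipschitz constant of
`y ↦ ∇_x l(y, λ*_I)` for every index set `I ⊆ {1,…,n_g}` (encoded by quantifying over all
KKT multipliers of restricted problems), the iterates `x_{k+1} = x_k + T v(x_k)` converge to
the unique minimizer `x*` of `f` over `C`, and `d(x_k)` increases monotonically to `f*`. -/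
theorem stmt18
    {E : Type*} [NormedAddCommGroup E] [InnerProductSpace ℝ E] [FiniteDimensional ℝ E]
    {ng nh : ℕ} (hng : 0 < ng) (hnh : 0 < nh)
    (f : E → ℝ) (g : Fin ng → E → ℝ) (h : Fin nh → E → ℝ)
    (gf : E → E) (gg : Fin ng → E → E) (gh : Fin nh → E → E)
    (hf : ∀ y, HasGradientAt f (gf y) y)
    (hg : ∀ i y, HasGradientAt (g i) (gg i y) y)
    (hh : ∀ j y, HasGradientAt (h j) (gh j y) y)
    (hgfc : Continuous gf) (hggc : ∀ i, Continuous (gg i)) (hghc : ∀ j, Continuous (gh j))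
    -- Lipschitz gradients
    (Lf Lg Lh : ℝ)
    (hgfL : ∀ y z, ‖gf y - gf z‖ ≤ Lf * ‖y - z‖)
    (hggL : ∀ i y z, ‖gg i y - gg i z‖ ≤ Lg * ‖y - z‖)
    (hghL : ∀ j y z, ‖gh j y - gh j z‖ ≤ Lh * ‖y - z‖)
    -- MFCQ at every point
    (mfcq : ∀ x : E, LinearIndependent ℝ (fun j : Fin nh => gh j x) ∧
      ∃ w : E, (∀ j : Fin nh, ⟪gh j x, w⟫ = 0) ∧
        ∀ i : Fin ng, g i x ≤ 0 → 0 < ⟪gg i x, w⟫)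
    -- convexity assumption
    (hhaff : ∀ j, ConvexOn ℝ Set.univ (h j) ∧ ConcaveOn ℝ Set.univ (h j))
    (hgconc : ∀ i, ConcaveOn ℝ Set.univ (g i))
    {μ : ℝ} (hμ : 0 < μ) (hfsc : StrongConvexOn Set.univ μ f)
    (hcoer : Tendsto f (cocompact E) atTop)
    (hCne : {y : E | (∀ i, 0 ≤ g i y) ∧ ∀ j, h j y = 0}.Nonempty)
    (hCbd : Bornology.IsBounded {y : E | (∀ i, 0 ≤ g i y) ∧ ∀ j, h j y = 0})
    (xstar : E) (hxsC : (∀ i, 0 ≤ g i xstar) ∧ ∀ j, h j xstar = 0)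
    (hxsmin : ∀ y : E, ((∀ i, 0 ≤ g i y) ∧ ∀ j, h j y = 0) → f xstar ≤ f y)
    -- parameter range
    {α : ℝ} (hα0 : 0 < α) (hαμ : α < μ)
    -- the maximizer `λ(·) = (lamh ·, lamg ·) ∈ D_x` of the dual, and the dual function `d`
    (lamh : E → Fin nh → ℝ) (lamg : E → Fin ng → ℝ)
    (hlam_nn : ∀ y i, 0 ≤ lamg y i)
    (hlam_supp : ∀ y i, 0 < g i y → lamg y i = 0)
    (dval : E → ℝ)
    (hd_eq : ∀ y : E, dval y =
      (f y - ((∑ j : Fin nh, lamh y j * h j y) + ∑ i : Fin ng, lamg y i * g i y)) -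
        1/(2*α) * ‖gf y - ((∑ j : Fin nh, lamh y j • gh j y) +
          ∑ i : Fin ng, lamg y i • gg i y)‖^2)
    (hd_max : ∀ (y : E) (lh : Fin nh → ℝ) (lg : Fin ng → ℝ),
      (∀ i, 0 ≤ lg i) → (∀ i, 0 < g i y → lg i = 0) →
      (f y - ((∑ j : Fin nh, lh j * h j y) + ∑ i : Fin ng, lg i * g i y)) -
        1/(2*α) * ‖gf y - ((∑ j : Fin nh, lh j • gh j y) +
          ∑ i : Fin ng, lg i • gg i y)‖^2 ≤ dval y)
    -- the velocity field `v(·)` and its relation to `λ(·)`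
    (vfun : E → E)
    (hv_mem : ∀ y : E, (∀ j : Fin nh, ⟪gh j y, vfun y⟫ + α * h j y = 0) ∧
      ∀ i : Fin ng, g i y ≤ 0 → 0 ≤ ⟪gg i y, vfun y⟫ + α * g i y)
    (hv_min : ∀ y u : E, (∀ j : Fin nh, ⟪gh j y, u⟫ + α * h j y = 0) →
      (∀ i : Fin ng, g i y ≤ 0 → 0 ≤ ⟪gg i y, u⟫ + α * g i y) →
      1/2 * ‖vfun y + gf y‖^2 ≤ 1/2 * ‖u + gf y‖^2)
    (hv_lam : ∀ y : E, vfun y =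
      -(gf y - ((∑ j : Fin nh, lamh y j • gh j y) + ∑ i : Fin ng, lamg y i • gg i y)))
    -- the smoothness constant `L_l` of the Lagrangian with frozen multiplier `λ(x)`
    {Ll : ℝ} (hμLl : μ ≤ Ll)
    (hLl : ∀ y z z' : E,
      ‖(gf z - ((∑ j : Fin nh, lamh y j • gh j z) + ∑ i : Fin ng, lamg y i • gg i z)) -
        (gf z' - ((∑ j : Fin nh, lamh y j • gh j z') +
          ∑ i : Fin ng, lamg y i • gg i z'))‖ ≤ Ll * ‖z - z'‖)
    -- step size
    {T : ℝ} (hT0 : 0 < T) (hT : T ≤ 2 / (Ll + μ))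
    -- the iterates
    (xseq : ℕ → E)
    (hxs : ∀ k : ℕ, xseq (k + 1) = xseq k + T • vfun (xseq k))
    -- `L_l` also bounds the Lipschitz constant of `y ↦ ∇_x l(y, λ*_I)` for every restricted
    -- problem with index set `I` (encoded by the predicate `P`)
    (hLlKKT : ∀ (P : Fin ng → Prop) (z : E) (lh : Fin nh → ℝ) (lg : Fin ng → ℝ),
      (∀ j : Fin nh, h j z = 0) → (∀ i : Fin ng, P i → 0 ≤ g i z) →
      (∀ z' : E, ((∀ j : Fin nh, h j z' = 0) ∧ ∀ i : Fin ng, P i → 0 ≤ g i z') → f z ≤ f z') →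
      (∀ i, 0 ≤ lg i) → (∀ i, ¬ P i → lg i = 0) → (∀ i, lg i * g i z = 0) →
      (gf z = (∑ j : Fin nh, lh j • gh j z) + ∑ i : Fin ng, lg i • gg i z) →
      ∀ y y' : E,
        ‖(gf y - ((∑ j : Fin nh, lh j • gh j y) + ∑ i : Fin ng, lg i • gg i y)) -
          (gf y' - ((∑ j : Fin nh, lh j • gh j y') + ∑ i : Fin ng, lg i • gg i y'))‖ ≤
          Ll * ‖y - y'‖) :
    Tendsto xseq atTop (nhds xstar) ∧
    Monotone (fun k => dval (xseq k)) ∧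
    Tendsto (fun k => dval (xseq k)) atTop (nhds (f xstar)) := by
  have hlow (y : E) := lagrangian_add_inner_gradient_le hf hg hh hhaff hgconc hfsc
    (lamh y) (hlam_nn y)
  have hgrad (y : E) := hasGradientAt_lagrangian hf hg hh (lamh y) (lamg y)
  have hGv (y : E) : gf y - ((∑ j, lamh y j • gh j y) + ∑ i, lamg y i • gg i y) = -vfun y := by
    rw [hv_lam y, neg_neg]
  have hTL : T * (Ll + μ) ≤ 2 := (le_div_iff₀ (by linarith)).1 hT
  have hTμ : μ * T ≤ 1 := by nlinarith
  have hαT : α * T ≤ 1 := by nlinarith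
  -- complementary slackness
  have hcompl (y : E) (i : Fin ng) : lamg y i * (⟪gg i y, vfun y⟫ + α * g i y) = 0 := by
    have hnn (i : Fin ng) : 0 ≤ lamg y i * (⟪gg i y, vfun y⟫ + α * g i y) := by
      rcases lt_or_ge 0 (g i y) with hi | hi
      · rw [hlam_supp y i hi, zero_mul]
      · exact mul_nonneg (hlam_nn y i) ((hv_mem y).2 i hi)
    suffices hS : ∑ i, lamg y i * (⟪gg i y, vfun y⟫ + α * g i y) = 0 from
      (Finset.sum_eq_zero_iff_of_nonneg fun i _ => hnn i).1 hS i (Finset.mem_univ i)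
    refine le_antisymm ?_ (Finset.sum_nonneg fun i _ => hnn i)
    set U := ∑ i, lamg y i • gg i y with hU
    set R := ∑ i, lamg y i * g i y with hR
    have hSR : ∑ i, lamg y i * (⟪gg i y, vfun y⟫ + α * g i y) = ⟪U, vfun y⟫ + α * R := by
      simp only [hU, hR, sum_inner, real_inner_smul_left, Finset.mul_sum, mul_add,
        Finset.sum_add_distrib, mul_left_comm]
    have hbound (t : ℝ) (ht0 : 0 < t) (ht1 : t ≤ 1) :
        ⟪U, vfun y⟫ + α * R ≤ t * (‖U‖ ^ 2 / 2) := by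
      have hmax := hd_max y (lamh y) (fun i => (1 - t) * lamg y i)
        (fun i => mul_nonneg (by linarith) (hlam_nn y i))
        (fun i hi => by rw [hlam_supp y i hi, mul_zero])
      simp only [mul_assoc, mul_smul, ← Finset.mul_sum, ← Finset.smul_sum] at hmax
      rw [← hU, ← hR, hd_eq, ← hU, ← hR] at hmax
      have e1 : gf y - (∑ j, lamh y j • gh j y + (1 - t) • U) = t • U - vfun y := by
        rw [sub_smul, one_smul, ← neg_add_eq_sub (vfun y), ← hGv y]; abel
      rw [e1, hGv y, norm_neg, norm_sub_sq_real, norm_smul, mul_pow, Real.norm_eq_abs, sq_abs,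
        real_inner_smul_left] at hmax
      have hmul := mul_le_mul_of_nonneg_left hmax (mul_pos two_pos hα0).le
      field_simp at hmul
      have : t * (⟪U, vfun y⟫ + α * R) ≤ t * (t * (‖U‖ ^ 2 / 2)) := by linarith
      exact le_of_mul_le_mul_left this ht0
    rw [hSR]
    have hlim : Tendsto (fun t : ℝ => t * (‖U‖ ^ 2 / 2)) (nhdsWithin 0 (Set.Ioi 0)) (nhds 0) := by
      refine ((continuous_mul_const (‖U‖ ^ 2 / 2)).tendsto' 0 0 (zero_mul _)).mono_left
        nhdsWithin_le_nhds
    refine ge_of_tendsto hlim ?_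
    filter_upwards [Ioc_mem_nhdsGT (zero_lt_one (α := ℝ))] with t ht using hbound t ht.1 ht.2
  -- the dual value in terms of the velocity
  have hd_v (y : E) : dval y = f y + (⟪gf y, vfun y⟫ + ‖vfun y‖ ^ 2 / 2) / α := by
    have e1 : ∑ j, lamh y j * ⟪gh j y, vfun y⟫ = -(α * ∑ j, lamh y j * h j y) := by
      rw [Finset.mul_sum, ← Finset.sum_neg_distrib]
      refine Finset.sum_congr rfl fun j _ => ?_
      linear_combination lamh y j * (hv_mem y).1 j
    have e2 : ∑ i, lamg y i * ⟪gg i y, vfun y⟫ = -(α * ∑ i, lamg y i * g i y) := by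
      rw [Finset.mul_sum, ← Finset.sum_neg_distrib]
      refine Finset.sum_congr rfl fun i _ => ?_
      linear_combination hcompl y i
    have e3 := congrArg (fun z => ⟪z, vfun y⟫) (hGv y)
    simp only [inner_sub_left, inner_add_left, sum_inner, real_inner_smul_left, inner_neg_left,
      real_inner_self_eq_norm_sq, e1, e2] at e3
    rw [hd_eq, hGv, norm_neg]
    field_simp
    linarith
  -- the dual gap controls the distance to the minimizer
  have hgap (y : E) : (μ - α) / 2 * ‖xstar - y‖ ^ 2 ≤ f xstar - dval y := by
    have h1 := hlow y y xstar
    have h2 : 0 ≤ ∑ i, lamg y i * g i xstar :=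
      Finset.sum_nonneg fun i _ => mul_nonneg (hlam_nn y i) (hxsC.1 i)
    simp only [hxsC.2, mul_zero, Finset.sum_const_zero, zero_add] at h1
    rw [hGv, inner_neg_left] at h1
    have h3 := hd_eq y
    rw [hGv, norm_neg] at h3
    have h4 : 0 ≤ ‖vfun y - α • (xstar - y)‖ ^ 2 / (2 * α) := by positivity
    rw [norm_sub_sq_real, norm_smul, mul_pow, Real.norm_eq_abs, sq_abs, real_inner_smul_right,
      show (‖vfun y‖ ^ 2 - 2 * (α * ⟪vfun y, xstar - y⟫) + α ^ 2 * ‖xstar - y‖ ^ 2) / (2 * α) =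
        1 / (2 * α) * ‖vfun y‖ ^ 2 - ⟪vfun y, xstar - y⟫ + α / 2 * ‖xstar - y‖ ^ 2 by
          field_simp] at h4
    linarith
  -- sufficient increase
  set c := (μ / α - 1) * (T / 2) with hc_def
  have hμα : 0 < μ / α - 1 := sub_pos.2 ((one_lt_div hα0).2 hαμ)
  have hc : 0 < c := mul_pos hμα (by linarith)
  have hstep (x : E) : c * ‖vfun x‖ ^ 2 ≤ dval (x + T • vfun x) - dval x := by
    have hmax := hd_max (x + T • vfun x) (lamh x) (lamg x) (hlam_nn x) fun i hi => by
      by_contra hne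
      have hgi : g i x ≤ 0 := not_lt.1 fun hpos => hne (hlam_supp x i hpos)
      have h0 := (mul_eq_zero.1 (hcompl x i)).resolve_left hne
      have h1 := (hgconc i).le_add_inner_gradient (hg i x) (x + T • vfun x)
      rw [add_sub_cancel_left, real_inner_smul_right] at h1
      nlinarith
    have hcontr := norm_gradient_step_sq_le hμ hμLl hT0 hT (hgrad x) (hlow x) (hLl x) x
    have hdec := hlow x (x + T • vfun x) x
    have hfwd := hlow x x (x + T • vfun x)
    simp only [hGv, smul_neg, sub_neg_eq_add, norm_neg] at hcontr
    rw [hGv, add_sub_cancel_left, inner_neg_left, real_inner_smul_right,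
      real_inner_self_eq_norm_sq, norm_smul, mul_pow, Real.norm_eq_abs, sq_abs] at hfwd
    have h3 := hd_eq x
    rw [hGv, norm_neg] at h3
    have h4 := mul_le_mul_of_nonneg_left hcontr (show 0 ≤ 1 / (2 * α) by positivity)
    have h5 : 1 / (2 * α) * ((1 - μ * T) ^ 2 * ‖vfun x‖ ^ 2) = 1 / (2 * α) * ‖vfun x‖ ^ 2
        - μ / α * (T - μ * T ^ 2 / 2) * ‖vfun x‖ ^ 2 := by
      field_simp; ring
    have h6 : 0 ≤ (μ / α - 1) * (T / 2 * (1 - μ * T)) * ‖vfun x‖ ^ 2 := by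
      have : 0 ≤ 1 - μ * T := by linarith
      positivity
    rw [hc_def]
    linarith
  have hinc (k : ℕ) : c * ‖vfun (xseq k)‖ ^ 2 ≤ dval (xseq (k + 1)) - dval (xseq k) := by
    rw [hxs k]; exact hstep (xseq k)
  have hmono : Monotone (fun k => dval (xseq k)) := monotone_nat_of_le_succ fun k => by
    have := mul_nonneg hc.le (sq_nonneg ‖vfun (xseq k)‖)
    linarith [hinc k]
  have hdist (k : ℕ) : ‖xstar - xseq k‖ ^ 2 ≤ (f xstar - dval (xseq k)) / ((μ - α) / 2) := by
    rw [le_div_iff₀' (by linarith)]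
    exact hgap (xseq k)
  have hle (k : ℕ) : dval (xseq k) ≤ f xstar := by
    have : 0 ≤ (μ - α) / 2 * ‖xstar - xseq k‖ ^ 2 := mul_nonneg (by linarith) (sq_nonneg _)
    linarith [hgap (xseq k)]
  obtain ⟨l, hl⟩ : ∃ l, Tendsto (fun k => dval (xseq k)) atTop (nhds l) :=
    ⟨_, tendsto_atTop_ciSup hmono ⟨f xstar, Set.forall_mem_range.2 hle⟩⟩
  have hv0 : Tendsto (fun k => vfun (xseq k)) atTop (nhds 0) := by
    have h1 : Tendsto (fun k => (dval (xseq (k + 1)) - dval (xseq k)) / c) atTop (nhds 0) := by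
      simpa using ((hl.comp (tendsto_add_atTop_nat 1)).sub hl).div_const c
    have h2 : Tendsto (fun k => ‖vfun (xseq k)‖ ^ 2) atTop (nhds 0) :=
      squeeze_zero (fun k => sq_nonneg _) (fun k => (le_div_iff₀' hc).2 (hinc k)) h1
    rw [tendsto_zero_iff_norm_tendsto_zero]
    simpa using h2.sqrt
  -- a limit point of the iterates is feasible and attains the limit of the dual values
  have hlf : f xstar ≤ l := by
    have hbd (k : ℕ) : xseq k ∈
        Metric.closedBall xstar √((f xstar - dval (xseq 0)) / ((μ - α) / 2)) := by
      rw [mem_closedBall_iff_norm']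
      refine Real.le_sqrt_of_sq_le ((hdist k).trans ?_)
      have := hmono (Nat.zero_le k)
      have h2 : 0 ≤ (μ - α) / 2 := by linarith
      simp only at this
      gcongr
    obtain ⟨a, -, φ, hφ, ha⟩ := tendsto_subseq_of_bounded Metric.isBounded_closedBall hbd
    have hv := hv0.comp hφ.tendsto_atTop
    have lim {F : E → ℝ} {G : E → E} (hF : ∀ y, HasGradientAt F (G y) y) (hG : Continuous G) :
        Tendsto (fun k => F (xseq (φ k))) atTop (nhds (F a)) ∧
          Tendsto (fun k => ⟪G (xseq (φ k)), vfun (xseq (φ k))⟫) atTop (nhds 0) :=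
      ⟨(hF a).continuousAt.tendsto.comp ha, by
        simpa using ((hG.tendsto a).comp ha).inner hv⟩
    have hah (j : Fin nh) : h j a = 0 := by
      obtain ⟨h1, h2⟩ := lim (hh j) (hghc j)
      have h3 := h2.add (h1.const_mul α)
      simp only [(hv_mem _).1 j, zero_add] at h3
      exact (mul_eq_zero.1 (tendsto_nhds_unique h3 tendsto_const_nhds)).resolve_left hα0.ne'
    have hag (i : Fin ng) : 0 ≤ g i a := by
      obtain ⟨h1, h2⟩ := lim (hg i) (hggc i)
      have h3 := ge_of_tendsto' (h1.max (h2.add (h1.const_mul α))) fun k => by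
        rcases lt_or_ge 0 (g i (xseq (φ k))) with hi | hi
        · exact hi.le.trans (le_max_left _ _)
        · exact ((hv_mem _).2 i hi).trans (le_max_right _ _)
      rw [zero_add, le_max_iff] at h3
      exact h3.elim id fun h4 => nonneg_of_mul_nonneg_right h4 hα0
    obtain ⟨h1, h2⟩ := lim hf hgfc
    have h3 : Tendsto (fun k => dval (xseq (φ k))) atTop (nhds (f a)) := by
      simp only [hd_v]
      simpa using h1.add ((h2.add ((hv.norm.pow 2).div_const 2)).div_const α)
    rw [tendsto_nhds_unique (hl.comp hφ.tendsto_atTop) h3]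
    exact hxsmin a ⟨hag, hah⟩
  obtain rfl : l = f xstar := le_antisymm (le_of_tendsto' hl hle) hlf
  refine ⟨?_, hmono, hl⟩
  have h1 : Tendsto (fun k => (f xstar - dval (xseq k)) / ((μ - α) / 2)) atTop (nhds 0) := by
    simpa using (hl.const_sub (f xstar)).div_const ((μ - α) / 2)
  have h2 := (squeeze_zero (fun k => sq_nonneg _) hdist h1).sqrt
  rw [tendsto_iff_norm_sub_tendsto_zero]
  simpa [norm_sub_rev] using h2
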